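/- For each n ≥ 1 let Δ_n be the cyclic backward difference operator on ℂ^{2^n} given by (Δ_n g)(j) = 2^n (g(j) − g((j−1) mod 2^n)). Then there exists a unique f_n ∈ ℂ^{2^n} minimizing ‖Δ_n − C_f‖_HS over all dyadic convolution operators C_f, and its Walsh coefficients are f_n^∼(Gm) = 2(m + m_0) for all m < 2^n, where Gm = m XOR ⌊m/2⌋ and m_0 = m mod 2. In particular the optimal coefficients γ(Gm) = 2(m_0 + m) do not depend on n, so the best approximations of the difference operators Δ_n at every scale n are the restrictions of one single generalized dyadic derivative D_γ. -/

import Mathlib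

/-- The `j`-th binary digit (`j ≥ 1`) of `x ∈ [0,1)`, using the terminating binary
expansion `x = Σ_{j≥1} x_j 2^{-j}` (the expansion ending in zeros for dyadic rationals). -/
noncomputable def dyadicDigit (j : ℕ) (x : ℝ) : ℕ := (⌊x * 2 ^ j⌋).toNat % 2

/-- The Walsh–Paley function `w_k` on `[0,1)`: `w_k(x) = (-1) ^ (Σ_{i≥0} k_i x_{i+1})`,
where `k = Σ_i k_i 2^i` (all bits of `k` lie below `k + 1`). -/
noncomputable def walsh (k : ℕ) (x : ℝ) : ℝ :=
  (-1 : ℝ) ^ (∑ i ∈ Finset.range (k + 1), (k.testBit i).toNat * dyadicDigit (i + 1) x)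

/-- `lastOnePos n x`: the largest index `r ∈ {1,…,n}` with `r`-th binary digit of `x`
equal to `1` (the position of the last nonzero digit); by convention it is `1` for `x = 0`. -/
noncomputable def lastOnePos (n : ℕ) (x : ℝ) : ℕ :=
  if x = 0 then 1 else ((Finset.Icc 1 n).filter (fun r => dyadicDigit r x = 1)).sup id

/-- The Gray code map `G m = m XOR ⌊m/2⌋`. -/
def grayCode (m : ℕ) : ℕ := m ^^^ (m / 2)

/-- The Walsh vector `W_k ∈ ℂ^{2^n}`, `W_k(j) = w_k(j/2^n)`. -/
noncomputable def walshVec (n k : ℕ) : Fin (2 ^ n) → ℂ :=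
  fun j => ((walsh k ((j : ℝ) / 2 ^ n) : ℝ) : ℂ)

/-- Dyadic convolution on `ℂ^{2^n}`: `(f ∗ g)(j) = 2^{-n} Σ_t f(j XOR t) g(t)`. -/
noncomputable def dconv (n : ℕ) (f g : Fin (2 ^ n) → ℂ) : Fin (2 ^ n) → ℂ :=
  fun j => (2 ^ n : ℂ)⁻¹ *
    ∑ t : Fin (2 ^ n), f ⟨j.val ^^^ t.val, Nat.xor_lt_two_pow j.isLt t.isLt⟩ * g t

/-- The Walsh coefficients `f^∼(k) = 2^{-n} Σ_j f(j) w_k(j/2^n)` of `f ∈ ℂ^{2^n}`. -/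
noncomputable def walshCoeff (n : ℕ) (f : Fin (2 ^ n) → ℂ) (k : ℕ) : ℂ :=
  (2 ^ n : ℂ)⁻¹ * ∑ j : Fin (2 ^ n), f j * ((walsh k ((j : ℝ) / 2 ^ n) : ℝ) : ℂ)

/-- The normalized inner product `⟨u,v⟩ = 2^{-n} Σ_j u(j) conj(v(j))` on `ℂ^{2^n}`. -/
noncomputable def ninner (n : ℕ) (u v : Fin (2 ^ n) → ℂ) : ℂ :=
  (2 ^ n : ℂ)⁻¹ * ∑ j : Fin (2 ^ n), u j * (starRingEnd ℂ) (v j)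

/-- The squared Hilbert–Schmidt norm `Σ_λ ‖A e_λ‖²` of an operator `A` on `ℂ^{2^n}`,
computed with respect to the normalized inner product `ninner`, using the orthonormal
basis `e_j = 2^{n/2} δ_j` (so `‖A e_j‖² = 2^n ⟨A δ_j, A δ_j⟩`). -/
noncomputable def hsNormSq (n : ℕ) (A : (Fin (2 ^ n) → ℂ) → (Fin (2 ^ n) → ℂ)) : ℝ :=
  ∑ j : Fin (2 ^ n), (2 ^ n : ℝ) * (ninner n (A (Pi.single j 1)) (A (Pi.single j 1))).re

/-- The index `(j - 1) mod 2^n`. -/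
def predIdx (n : ℕ) (j : Fin (2 ^ n)) : Fin (2 ^ n) :=
  ⟨(j.val + (2 ^ n - 1)) % 2 ^ n, Nat.mod_lt _ (Nat.two_pow_pos n)⟩

/-- The index `(j + 1) mod 2^n`. -/
def succIdx (n : ℕ) (j : Fin (2 ^ n)) : Fin (2 ^ n) :=
  ⟨(j.val + 1) % 2 ^ n, Nat.mod_lt _ (Nat.two_pow_pos n)⟩

/-- The cyclic backward difference operator `Δ_n` on `ℂ^{2^n}`:
`(Δ_n g)(j) = 2^n (g(j) - g((j-1) mod 2^n))`. -/
noncomputable def diffOp (n : ℕ) (v : Fin (2 ^ n) → ℂ) : Fin (2 ^ n) → ℂ :=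
  fun j => (2 ^ n : ℂ) * (v j - v (predIdx n j))

/-- The squared Hilbert–Schmidt norm is the sum of the squared matrix entries. -/
lemma hsNormSq_eq_sum_normSq (n : ℕ) (A : (Fin (2 ^ n) → ℂ) → (Fin (2 ^ n) → ℂ)) :
    hsNormSq n A = ∑ j, ∑ i, Complex.normSq (A (Pi.single j 1) i) := by
  unfold hsNormSq ninner
  refine Finset.sum_congr rfl fun j _ => ?_
  have h : (2 ^ n : ℂ)⁻¹ * ∑ i, A (Pi.single j 1) i * (starRingEnd ℂ) (A (Pi.single j 1) i)
      = (((2 ^ n : ℝ)⁻¹ * ∑ i, Complex.normSq (A (Pi.single j 1) i) : ℝ) : ℂ) := by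
    push_cast
    simp only [Complex.mul_conj]
  rw [h, Complex.ofReal_re, mul_inv_cancel_left₀ (by positivity)]

/-- Translation by `i` in the dyadic group on `Fin (2 ^ n)`. -/
def xorEquiv (n : ℕ) (i : Fin (2 ^ n)) : Fin (2 ^ n) ≃ Fin (2 ^ n) where
  toFun s := ⟨i.val ^^^ s.val, Nat.xor_lt_two_pow i.isLt s.isLt⟩
  invFun s := ⟨i.val ^^^ s.val, Nat.xor_lt_two_pow i.isLt s.isLt⟩
  left_inv s := by ext; simp
  right_inv s := by ext; simp

lemma xorEquiv_xorEquiv (n : ℕ) (i s : Fin (2 ^ n)) : xorEquiv n i (xorEquiv n i s) = s :=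
  (xorEquiv n i).left_inv s

/-- The matrix of the difference operator. -/
noncomputable def diffEntry (n : ℕ) (i j : Fin (2 ^ n)) : ℂ := diffOp n (Pi.single j 1) i

/-- The average of the matrix entries of the difference operator along the dyadic diagonals,
scaled so that it is the kernel of a dyadic convolution. -/
noncomputable def bestKernel (n : ℕ) (s : Fin (2 ^ n)) : ℂ :=
  ∑ i, diffEntry n i (xorEquiv n i s)

lemma hsNormSq_diffOp_sub_dconv (n : ℕ) (f : Fin (2 ^ n) → ℂ) :
    hsNormSq n (fun v => diffOp n v - dconv n f v) =
      ∑ s, ∑ i, Complex.normSq (diffEntry n i (xorEquiv n i s) - (2 ^ n : ℂ)⁻¹ * f s) := by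
  rw [hsNormSq_eq_sum_normSq, Finset.sum_comm]
  conv_rhs => rw [Finset.sum_comm]
  refine Finset.sum_congr rfl fun i _ => ?_
  rw [← Equiv.sum_comp (xorEquiv n i)]
  refine Finset.sum_congr rfl fun s _ => ?_
  have h : dconv n f (Pi.single (xorEquiv n i s) 1) i = (2 ^ n : ℂ)⁻¹ * f s := by
    unfold dconv
    rw [Finset.sum_eq_single (xorEquiv n i s)]
    · rw [Pi.single_eq_same, mul_one]
      exact congrArg (fun t => (2 ^ n : ℂ)⁻¹ * f t) (xorEquiv_xorEquiv n i s)
    · intro t _ ht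
      rw [Pi.single_eq_of_ne ht, mul_zero]
    · simp
  rw [Pi.sub_apply, h, diffEntry]

/-- The mean minimizes the sum of squared distances. -/
lemma sum_normSq_sub_eq {ι : Type*} [Fintype ι] (a : ι → ℂ) {c : ℂ}
    (hc : ∑ i, (a i - c) = 0) (z : ℂ) :
    ∑ i, Complex.normSq (a i - z) =
      ∑ i, Complex.normSq (a i - c) + Fintype.card ι * Complex.normSq (c - z) := by
  have h : ∀ i, Complex.normSq (a i - z) = Complex.normSq (a i - c) + Complex.normSq (c - z)
      + 2 * ((a i - c) * (starRingEnd ℂ) (c - z)).re := fun i => by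
    rw [← Complex.normSq_add, sub_add_sub_cancel]
  simp only [h, Finset.sum_add_distrib, ← Finset.mul_sum, ← Complex.re_sum, ← Finset.sum_mul, hc]
  simp

lemma hsNormSq_eq_add_bestKernel (n : ℕ) (f : Fin (2 ^ n) → ℂ) :
    hsNormSq n (fun v => diffOp n v - dconv n f v) =
      hsNormSq n (fun v => diffOp n v - dconv n (bestKernel n) v)
        + ∑ s, 2 ^ n * Complex.normSq ((2 ^ n : ℂ)⁻¹ * bestKernel n s - (2 ^ n : ℂ)⁻¹ * f s) := by
  rw [hsNormSq_diffOp_sub_dconv, hsNormSq_diffOp_sub_dconv, ← Finset.sum_add_distrib]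
  refine Finset.sum_congr rfl fun s _ => ?_
  rw [sum_normSq_sub_eq _ (c := (2 ^ n : ℂ)⁻¹ * bestKernel n s)]
  · simp
  · rw [Finset.sum_sub_distrib]
    simp [bestKernel]

lemma isMinimizer_iff_eq_bestKernel (n : ℕ) (f : Fin (2 ^ n) → ℂ) :
    (∀ g : Fin (2 ^ n) → ℂ, hsNormSq n (fun v => diffOp n v - dconv n f v)
      ≤ hsNormSq n (fun v => diffOp n v - dconv n g v)) ↔ f = bestKernel n := by
  constructor
  · intro h
    have h1 := h (bestKernel n)
    rw [hsNormSq_eq_add_bestKernel n f] at h1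
    have h2 : ∀ s ∈ Finset.univ, (0 : ℝ) ≤
        2 ^ n * Complex.normSq ((2 ^ n : ℂ)⁻¹ * bestKernel n s - (2 ^ n : ℂ)⁻¹ * f s) :=
      fun s _ => mul_nonneg (by positivity) (Complex.normSq_nonneg _)
    have h3 := (Finset.sum_eq_zero_iff_of_nonneg h2).1
      (le_antisymm (by linarith) (Finset.sum_nonneg h2))
    funext s
    have h4 := h3 s (Finset.mem_univ s)
    rw [mul_eq_zero_iff_left (by positivity), Complex.normSq_eq_zero, ← mul_sub,
      mul_eq_zero_iff_left (inv_ne_zero (pow_ne_zero n two_ne_zero)), sub_eq_zero] at h4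
    exact h4.symm
  · rintro rfl g
    rw [hsNormSq_eq_add_bestKernel n g]
    exact le_add_of_nonneg_right (Finset.sum_nonneg fun s _ =>
      mul_nonneg (by positivity) (Complex.normSq_nonneg _))

lemma dyadicDigit_div_two_pow {n i : ℕ} (hi : i < n) (j : ℕ) :
    dyadicDigit (i + 1) ((j : ℝ) / 2 ^ n) = (j.testBit (n - 1 - i)).toNat := by
  have h : (j : ℝ) / 2 ^ n * 2 ^ (i + 1) = (j : ℝ) / ((2 ^ (n - 1 - i) : ℕ) : ℝ) := by
    have h2 : (2 : ℝ) ^ n = 2 ^ (n - 1 - i) * 2 ^ (i + 1) := by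
      rw [← pow_add]
      congr 1
      omega
    rw [h2]
    push_cast
    field_simp
  rw [dyadicDigit, h, Int.floor_toNat, Nat.floor_div_eq_div, Nat.toNat_testBit]

lemma walsh_div_two_pow {n k : ℕ} (hk : k < 2 ^ n) (j : ℕ) :
    walsh k ((j : ℝ) / 2 ^ n) = (-1) ^
      ∑ i ∈ Finset.range n, (k.testBit i).toNat * (j.testBit (n - 1 - i)).toNat := by
  have hlt : ∀ i, k.testBit i = true → i < n ∧ i < k + 1 := fun i hi => by
    have h1 := Nat.ge_two_pow_of_testBit hi
    have h2 := Nat.lt_two_pow_self (n := i)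
    exact ⟨(Nat.pow_lt_pow_iff_right (by norm_num : 1 < 2)).1 (h1.trans_lt hk), by omega⟩
  have h : ∀ (a : ℕ) (F : ℕ → ℕ), (∀ i, k.testBit i = true → i < a) →
      ∑ i ∈ Finset.range a, (k.testBit i).toNat * F i =
        ∑ i ∈ Finset.range (n + (k + 1)) with k.testBit i = true, F i := fun a F ha => by
    rw [← Finset.sum_subset (s₁ := (Finset.range (n + (k + 1))).filter (k.testBit · = true))]
    · exact Finset.sum_congr rfl fun i hi => by simp [(Finset.mem_filter.1 hi).2]
    · exact fun i hi => Finset.mem_range.2 (ha i (Finset.mem_filter.1 hi).2)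
    · intro i _ hi
      by_cases hb : k.testBit i = true
      · have := (hlt i hb).1
        exact absurd (Finset.mem_filter.2 ⟨Finset.mem_range.2 (by omega), hb⟩) hi
      · simp [hb]
  rw [walsh, h _ _ fun i hi => (hlt i hi).2, h _ _ fun i hi => (hlt i hi).1]
  congr 1
  refine Finset.sum_congr rfl fun i hi => dyadicDigit_div_two_pow (hlt i ?_).1 j
  exact (Finset.mem_filter.1 hi).2

lemma grayCode_lt {n m : ℕ} (hm : m < 2 ^ n) : grayCode m < 2 ^ n :=
  Nat.xor_lt_two_pow hm ((Nat.div_le_self m 2).trans_lt hm)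

lemma testBit_grayCode (m i : ℕ) :
    (grayCode m).testBit i = (m.testBit i ^^ m.testBit (i + 1)) := by
  rw [grayCode, Nat.testBit_xor, Nat.testBit_succ]

lemma neg_one_pow_sum_testBit_grayCode (m : ℕ) {e n : ℕ} (h : e ≤ n) :
    (-1 : ℝ) ^ ∑ i ∈ Finset.Ico e n, ((grayCode m).testBit i).toNat =
      (-1) ^ (m.testBit e).toNat * (-1) ^ (m.testBit n).toNat := by
  induction n, h using Nat.le_induction with
  | base => cases m.testBit e <;> simp
  | succ n hn ih =>
    rw [Finset.sum_Ico_succ_top hn, pow_add, ih, testBit_grayCode]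
    cases m.testBit e <;> cases m.testBit n <;> cases m.testBit (n + 1) <;> simp

lemma walsh_grayCode {n m e : ℕ} (hm : m < 2 ^ n) (he : e ≤ n) :
    walsh (grayCode m) (((2 ^ (n - e) - 1 : ℕ) : ℝ) / 2 ^ n) = (-1) ^ (m.testBit e).toNat := by
  have h := neg_one_pow_sum_testBit_grayCode m he
  rw [Nat.testBit_lt_two_pow hm, Bool.toNat_false, pow_zero, mul_one] at h
  rw [walsh_div_two_pow (grayCode_lt hm), ← h]
  congr 1
  rw [← Finset.sum_subset (s₁ := Finset.Ico e n)]
  · refine Finset.sum_congr rfl fun i hi => ?_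
    have := Finset.mem_Ico.1 hi
    rw [Nat.testBit_two_pow_sub_one, decide_eq_true (by omega), Bool.toNat_true, mul_one]
  · exact fun i hi => Finset.mem_range.2 (Finset.mem_Ico.1 hi).2
  · intro i hi hi'
    rw [Finset.mem_range] at hi
    rw [Finset.mem_Ico] at hi'
    rw [Nat.testBit_two_pow_sub_one, decide_eq_false (by omega), Bool.toNat_false, mul_zero]

lemma sum_range_two_mul {M : Type*} [AddCommMonoid M] (a : ℕ → M) (m : ℕ) :
    ∑ j ∈ Finset.range (2 * m), a j = ∑ i ∈ Finset.range m, (a (2 * i) + a (2 * i + 1)) := by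
  induction m with
  | zero => simp
  | succ m ih =>
    rw [Nat.mul_succ, Finset.sum_range_succ, Finset.sum_range_succ, ih,
      Finset.sum_range_succ _ m, add_assoc]

/-- Among `1 ≤ j < 2 ^ n` the value `j XOR (j - 1)` is `2 ^ (n - e) - 1` exactly `2 ^ e` times. -/
lemma sum_xor_pred (n : ℕ) (h : ℕ → ℝ) :
    ∑ j ∈ Finset.range (2 ^ n), (if j = 0 then 0 else h (j ^^^ (j - 1))) =
      ∑ e ∈ Finset.range n, 2 ^ e * h (2 ^ (n - e) - 1) := by
  induction n generalizing h with
  | zero => simp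
  | succ n ih =>
    rw [pow_succ', sum_range_two_mul, Finset.sum_add_distrib, Finset.sum_range_succ, add_comm]
    have hodd : ∀ i : ℕ, (2 * i + 1) ^^^ (2 * i + 1 - 1) = 1 := fun i => by
      apply Nat.eq_of_testBit_eq
      intro k
      cases k with
      | zero => simp
      | succ k =>
        rw [Nat.testBit_xor, Nat.testBit_succ, Nat.testBit_succ, Nat.testBit_succ,
          show (2 * i + 1 - 1) / 2 = i by omega, show (2 * i + 1) / 2 = i by omega]
        simp
    have heven : ∀ i : ℕ, i ≠ 0 → (2 * i) ^^^ (2 * i - 1) = 2 * (i ^^^ (i - 1)) + 1 := fun i hi => by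
      apply Nat.eq_of_testBit_eq
      intro k
      cases k with
      | zero => simp; omega
      | succ k =>
        rw [Nat.testBit_xor, Nat.testBit_succ, Nat.testBit_succ, Nat.testBit_succ, show 2 * i / 2 = i by omega, show (2 * i - 1) / 2 = i - 1 by omega,
          show (2 * (i ^^^ (i - 1)) + 1) / 2 = i ^^^ (i - 1) by omega, Nat.testBit_xor]
    have h1 : ∀ i ∈ Finset.range (2 ^ n),
        (if 2 * i = 0 then 0 else h ((2 * i) ^^^ (2 * i - 1))) =
          if i = 0 then 0 else (fun x => h (2 * x + 1)) (i ^^^ (i - 1)) := fun i _ => by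
      by_cases hi : i = 0
      · simp [hi]
      · simp [hi, heven i hi]
    rw [Finset.sum_congr rfl h1, ih fun x => h (2 * x + 1)]
    simp only [hodd]
    rw [add_comm]
    congr 1
    · refine Finset.sum_congr rfl fun e he => ?_
      rw [Finset.mem_range] at he
      have h2 : 2 * (2 ^ (n - e) - 1) + 1 = 2 ^ (n + 1 - e) - 1 := by
        rw [Nat.sub_add_comm he.le, pow_succ']
        have := Nat.two_pow_pos (n - e)
        omega
      simp only [h2]
    · simp

lemma sum_two_pow_mul_neg_one_pow_testBit (n m : ℕ) :
    ∑ e ∈ Finset.range n, (2 : ℝ) ^ e * (-1) ^ (m.testBit e).toNat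
      = 2 ^ n - 1 - 2 * (m % 2 ^ n : ℕ) := by
  induction n with
  | zero => simp [Nat.mod_one]
  | succ n ih =>
    rw [Finset.sum_range_succ, ih, Nat.mod_pow_succ, ← Nat.toNat_testBit]
    cases m.testBit n <;> push_cast <;> simp <;> ring

lemma sum_xor_predIdx (n : ℕ) (h : ℕ → ℝ) :
    ∑ j : Fin (2 ^ n), h (j.val ^^^ (predIdx n j).val) =
      h (2 ^ n - 1) + ∑ e ∈ Finset.range n, 2 ^ e * h (2 ^ (n - e) - 1) := by
  have hs : ∀ j : Fin (2 ^ n), h (j.val ^^^ (predIdx n j).val) =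
      (if j.val = 0 then h (2 ^ n - 1) else 0)
        + if j.val = 0 then 0 else h (j.val ^^^ (j.val - 1)) := fun j => by
    have hj := j.isLt
    have hp : (predIdx n j).val = (j.val + (2 ^ n - 1)) % 2 ^ n := rfl
    by_cases h0 : j.val = 0
    · rw [hp, h0, zero_add, Nat.mod_eq_of_lt (by omega), Nat.zero_xor, if_pos rfl, if_pos rfl,
        add_zero]
    · rw [hp, show j.val + (2 ^ n - 1) = j.val - 1 + 2 ^ n by omega, Nat.add_mod_right,
        Nat.mod_eq_of_lt (by omega), if_neg h0, if_neg h0, zero_add]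
  rw [Finset.sum_congr rfl fun j _ => hs j, Finset.sum_add_distrib,
    Fin.sum_univ_eq_sum_range (fun j => if j = 0 then h (2 ^ n - 1) else 0),
    Fin.sum_univ_eq_sum_range (fun j => if j = 0 then 0 else h (j ^^^ (j - 1))), sum_xor_pred,
    Finset.sum_ite_eq', if_pos (Finset.mem_range.2 (Nat.two_pow_pos n))]

lemma sum_walsh_xor_predIdx {n m : ℕ} (hm : m < 2 ^ n) :
    ∑ j : Fin (2 ^ n), walsh (grayCode m) (((j.val ^^^ (predIdx n j).val : ℕ) : ℝ) / 2 ^ n)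
      = 2 ^ n - 2 * (m + (m % 2 : ℕ)) := by
  have h1 : ∀ e ∈ Finset.range n,
      (2 : ℝ) ^ e * walsh (grayCode m) (((2 ^ (n - e) - 1 : ℕ) : ℝ) / 2 ^ n) =
        2 ^ e * (-1) ^ (m.testBit e).toNat := fun e he => by
    rw [walsh_grayCode hm (Finset.mem_range.1 he).le]
  have h2 := walsh_grayCode hm (Nat.zero_le n)
  rw [Nat.sub_zero] at h2
  rw [sum_xor_predIdx n fun s => walsh (grayCode m) ((s : ℝ) / 2 ^ n),
    Finset.sum_congr rfl h1, sum_two_pow_mul_neg_one_pow_testBit, h2, Nat.mod_eq_of_lt hm,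
    Nat.testBit_zero]
  rcases Nat.mod_two_eq_zero_or_one m with h3 | h3 <;> simp [h3] <;> ring

lemma walshCoeff_bestKernel (n k : ℕ) (hk : k < 2 ^ n) :
    walshCoeff n (bestKernel n) k = ((2 ^ n -
      ∑ j : Fin (2 ^ n), walsh k (((j.val ^^^ (predIdx n j).val : ℕ) : ℝ) / 2 ^ n) : ℝ) : ℂ) := by
  have hsum : ∑ s, bestKernel n s * ((walsh k ((s.val : ℝ) / 2 ^ n) : ℝ) : ℂ) =
      ∑ i : Fin (2 ^ n), (2 ^ n : ℂ) *
        (1 - ((walsh k (((i.val ^^^ (predIdx n i).val : ℕ) : ℝ) / 2 ^ n) : ℝ) : ℂ)) := by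
    simp only [bestKernel, Finset.sum_mul]
    rw [Finset.sum_comm]
    refine Finset.sum_congr rfl fun i _ => ?_
    rw [← Equiv.sum_comp (xorEquiv n i)]
    simp only [xorEquiv_xorEquiv, diffEntry, diffOp, mul_assoc, ← Finset.mul_sum, sub_mul,
      Finset.sum_sub_distrib, Pi.single_apply, ite_mul, one_mul, zero_mul, Finset.sum_ite_eq,
      Finset.mem_univ, if_true]
    have h0 : walsh k (((xorEquiv n i i).val : ℝ) / 2 ^ n) = 1 := by
      have : (xorEquiv n i i).val = 0 := Nat.xor_self _
      rw [this, walsh_div_two_pow hk]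
      simp
    rw [h0, Complex.ofReal_one]
    rfl
  rw [walshCoeff, hsum, ← Finset.mul_sum, inv_mul_cancel_left₀ (pow_ne_zero n two_ne_zero)]
  simp

/-- for each `n ≥ 1` there is a unique `f ∈ ℂ^{2^n}` minimizing
`‖Δ_n - C_f‖_HS`, and its Walsh coefficients are `f^∼(Gm) = 2(m + m_0)` for all
`m < 2^n` (`m_0 = m mod 2`); in particular the optimal coefficients `γ(Gm) = 2(m_0+m)`
do not depend on `n`, so the best approximations at every scale are restrictions of
one single generalized dyadic derivative `D_γ`. -/
theorem best_approx_difference (n : ℕ) (hn : 1 ≤ n) :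
    (∃! f : Fin (2 ^ n) → ℂ, ∀ g : Fin (2 ^ n) → ℂ,
        hsNormSq n (fun v => diffOp n v - dconv n f v)
          ≤ hsNormSq n (fun v => diffOp n v - dconv n g v)) ∧
    (∀ f : Fin (2 ^ n) → ℂ,
      (∀ g : Fin (2 ^ n) → ℂ,
          hsNormSq n (fun v => diffOp n v - dconv n f v)
            ≤ hsNormSq n (fun v => diffOp n v - dconv n g v)) →
      ∀ m < 2 ^ n, walshCoeff n f (grayCode m)
        = 2 * ((m : ℂ) + ((m % 2 : ℕ) : ℂ))) := by
  refine ⟨⟨bestKernel n, (isMinimizer_iff_eq_bestKernel n _).2 rfl,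
    fun f hf => (isMinimizer_iff_eq_bestKernel n f).1 hf⟩, fun f hf m hm => ?_⟩
  rw [(isMinimizer_iff_eq_bestKernel n f).1 hf, walshCoeff_bestKernel n _ (grayCode_lt hm),
    sum_walsh_xor_predIdx hm]
  push_cast
  ring
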